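/- arXiv:1708.02345 — 3 statements merged into one kernel-verified Lean document; each statement's English description precedes it below -/
import Mathlib

section
/- Let A be a hyponormal bounded operator on a complex Hilbert space and let ξ = inf over unit vectors x of ⟨(|A| - |A*|)x, x⟩ / ⟨(|A| + |A*|)x, x⟩ (assuming the denominators are positive). Then the numerical radius satisfies ω(A) ≤ (1 / (2·(1 + ξ²/8)))·‖ |A| + |A*| ‖. -/
open scoped InnerProductSpace
open ContinuousLinearMap

set_option synthInstance.maxHeartbeats 1000000

/-- The absolute value `|A| = (A*A)^{1/2}` of an operator. -/
noncomputable def opAbs {H : Type*} [NormedAddCommGroup H] [InnerProductSpace ℂ H]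
    [CompleteSpace H] (A : H →L[ℂ] H) : H →L[ℂ] H :=
  CFC.sqrt (adjoint A * A)

/-- The numerical radius. -/
noncomputable def numRadius {H : Type*} [NormedAddCommGroup H] [InnerProductSpace ℂ H]
    (A : H →L[ℂ] H) : ℝ :=
  ⨆ x : {x : H // ‖x‖ = 1}, ‖⟪(x : H), A x⟫_ℂ‖

section MixedSchwarz

variable {H : Type*} [NormedAddCommGroup H] [InnerProductSpace ℂ H]

lemma re_inner_nonneg_of_nonneg {M : H →L[ℂ] H} (hM : 0 ≤ M) (x : H) :
    0 ≤ (⟪x, M x⟫_ℂ).re :=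
  ((nonneg_iff_isPositive M).1 hM).re_inner_nonneg_right x

lemma re_inner_le_re_inner_of_le {M N : H →L[ℂ] H} (hMN : M ≤ N) (x : H) :
    (⟪x, M x⟫_ℂ).re ≤ (⟪x, N x⟫_ℂ).re := by
  have h : 0 ≤ (⟪x, (N - M) x⟫_ℂ).re := ((le_def M N).1 hMN).re_inner_nonneg_right x
  rw [sub_apply, inner_sub_right, Complex.sub_re] at h
  linarith

lemma norm_apply_le_norm_add_smul_apply {P : H →L[ℂ] H} (hP : 0 ≤ P) {ε : ℝ} (hε : 0 ≤ ε)
    (x : H) : ‖P x‖ ≤ ‖P x + (ε : ℂ) • x‖ := by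
  have h := norm_add_sq (𝕜 := ℂ) (P x) ((ε : ℂ) • x)
  have h' : 0 ≤ RCLike.re (⟪P x, (ε : ℂ) • x⟫_ℂ) := by
    rw [inner_smul_right, RCLike.re_eq_complex_re, Complex.re_ofReal_mul]
    exact mul_nonneg hε (((nonneg_iff_isPositive P).1 hP).re_inner_nonneg_left x)
  refine (sq_le_sq₀ (norm_nonneg _) (norm_nonneg _)).1 ?_
  nlinarith [sq_nonneg ‖(ε : ℂ) • x‖]

variable [CompleteSpace H]

/-- The Cauchy–Schwarz inequality for the semi-inner product of a positive operator. -/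
lemma norm_inner_sq_le_of_nonneg {M : H →L[ℂ] H} (hM : 0 ≤ M) (x y : H) :
    ‖⟪x, M y⟫_ℂ‖ ^ 2 ≤ (⟪x, M x⟫_ℂ).re * (⟪y, M y⟫_ℂ).re := by
  set S := CFC.sqrt M
  have hS : IsSelfAdjoint S := (CFC.sqrt_nonneg M).isSelfAdjoint
  have key (u v : H) : ⟪u, M v⟫_ℂ = ⟪S u, S v⟫_ℂ := by
    rw [← adjoint_inner_right, hS.adjoint_eq, ← comp_apply, ← mul_def, CFC.sqrt_mul_sqrt_self M hM]
  have hre (u : H) : (⟪u, M u⟫_ℂ).re = ‖S u‖ ^ 2 := by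
    rw [key, inner_self_eq_norm_sq_to_K]
    norm_cast
  rw [hre, hre, key, ← mul_pow]
  gcongr
  exact norm_inner_le_norm _ _

lemma norm_apply_sq_eq (B : H →L[ℂ] H) (x : H) :
    ‖B x‖ ^ 2 = (⟪x, (adjoint B * B) x⟫_ℂ).re := by
  rw [mul_def, comp_apply, adjoint_inner_right, inner_self_eq_norm_sq_to_K]
  norm_cast

lemma adjoint_mul_self_le_of_norm_apply_le {B C : H →L[ℂ] H} (h : ∀ x, ‖B x‖ ≤ ‖C x‖) :
    adjoint B * B ≤ adjoint C * C := by
  rw [le_def, isPositive_def']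
  refine ⟨(IsSelfAdjoint.star_mul_self C).sub (IsSelfAdjoint.star_mul_self B), fun x ↦ ?_⟩
  have hsq : ‖B x‖ ^ 2 ≤ ‖C x‖ ^ 2 := by
    gcongr
    exact h x
  rw [norm_apply_sq_eq, norm_apply_sq_eq] at hsq
  rw [reApplyInnerSelf_apply, inner_re_symm, sub_apply, inner_sub_right]
  simpa using hsq

lemma opAbs_le_opAbs_of_norm_apply_le {B C : H →L[ℂ] H} (h : ∀ x, ‖B x‖ ≤ ‖C x‖) :
    opAbs B ≤ opAbs C :=
  CFC.monotone_sqrt (adjoint_mul_self_le_of_norm_apply_le h)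

lemma opAbs_of_nonneg {R : H →L[ℂ] H} (hR : 0 ≤ R) : opAbs R = R := by
  rw [opAbs, hR.isSelfAdjoint.adjoint_eq, CFC.sqrt_mul_self R hR]

lemma opAbs_nonneg (A : H →L[ℂ] H) : 0 ≤ opAbs A := CFC.sqrt_nonneg _

lemma opAbs_mul_self (A : H →L[ℂ] H) : opAbs A * opAbs A = adjoint A * A :=
  CFC.sqrt_mul_sqrt_self _ (star_mul_self_nonneg A)

lemma norm_opAbs_apply (A : H →L[ℂ] H) (x : H) : ‖opAbs A x‖ = ‖A x‖ := by
  have h : ‖opAbs A x‖ ^ 2 = ‖A x‖ ^ 2 := by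
    rw [norm_apply_sq_eq, norm_apply_sq_eq, (opAbs_nonneg A).isSelfAdjoint.adjoint_eq,
      opAbs_mul_self]
  exact (sq_eq_sq₀ (norm_nonneg _) (norm_nonneg _)).1 h

lemma isStrictlyPositive_opAbs_add (A : H →L[ℂ] H) {ε : ℝ} (hε : 0 < ε) :
    IsStrictlyPositive (opAbs A + algebraMap ℝ (H →L[ℂ] H) ε) :=
  .nonneg_add (opAbs_nonneg A) (isStrictlyPositive_algebraMap hε)

/-- A regularised form of `A |A|⁻¹ A* ≤ |A*|`. -/
lemma mul_ringInverse_mul_adjoint_le (A : H →L[ℂ] H) {ε : ℝ} (hε : 0 < ε) :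
    A * Ring.inverse (opAbs A + algebraMap ℝ (H →L[ℂ] H) ε) * adjoint A ≤ opAbs (adjoint A) := by
  have hM := isStrictlyPositive_opAbs_add A hε
  set M := opAbs A + algebraMap ℝ (H →L[ℂ] H) ε with hMdef
  set T := Ring.inverse M
  have hR : 0 ≤ A * T * adjoint A := star_right_conjugate_nonneg hM.ringInverse.nonneg A
  rw [← opAbs_of_nonneg hR]
  refine opAbs_le_opAbs_of_norm_apply_le fun y ↦ ?_
  set z := T (adjoint A y)
  have hMz : opAbs A z + (ε : ℂ) • z = adjoint A y := calc
    opAbs A z + (ε : ℂ) • z = (M * T) (adjoint A y) := by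
      simp [hMdef, Algebra.algebraMap_eq_smul_one, z]
    _ = adjoint A y := by rw [Ring.mul_inverse_cancel M hM.isUnit, one_def, id_apply]
  calc ‖A z‖ = ‖opAbs A z‖ := (norm_opAbs_apply A z).symm
    _ ≤ ‖opAbs A z + (ε : ℂ) • z‖ :=
      norm_apply_le_norm_add_smul_apply (opAbs_nonneg A) hε.le z
    _ = ‖adjoint A y‖ := by rw [hMz]

/-- The mixed Schwarz inequality. -/
lemma norm_inner_apply_sq_le (A : H →L[ℂ] H) (x : H) :
    ‖⟪x, A x⟫_ℂ‖ ^ 2 ≤ (⟪x, opAbs A x⟫_ℂ).re * (⟪x, opAbs (adjoint A) x⟫_ℂ).re := by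
  have key (ε : ℝ) (hε : 0 < ε) : ‖⟪x, A x⟫_ℂ‖ ^ 2 ≤
      ((⟪x, opAbs A x⟫_ℂ).re + ε * ‖x‖ ^ 2) * (⟪x, opAbs (adjoint A) x⟫_ℂ).re := by
    have hR := mul_ringInverse_mul_adjoint_le A hε
    have hM := isStrictlyPositive_opAbs_add A hε
    set M := opAbs A + algebraMap ℝ (H →L[ℂ] H) ε with hMdef
    set T := Ring.inverse M
    have hT (u v : H) : ⟪T u, M v⟫_ℂ = ⟪u, v⟫_ℂ := by
      rw [← adjoint_inner_right, hM.ringInverse.isSelfAdjoint.adjoint_eq, ← comp_apply,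
        ← mul_def, Ring.inverse_mul_cancel M hM.isUnit, one_def, id_apply]
    have hMx : (⟪x, M x⟫_ℂ).re = (⟪x, opAbs A x⟫_ℂ).re + ε * ‖x‖ ^ 2 := by
      have hx : M x = opAbs A x + (ε : ℂ) • x := by
        simp [hMdef, Algebra.algebraMap_eq_smul_one]
      rw [hx, inner_add_right, inner_smul_right, inner_self_eq_norm_sq_to_K, Complex.add_re,
        Complex.re_ofReal_mul]
      norm_cast
    have h := norm_inner_sq_le_of_nonneg hM.nonneg (T (adjoint A x)) x
    rw [hT, hT, adjoint_inner_left, adjoint_inner_left, hMx, mul_comm] at h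
    refine h.trans (mul_le_mul_of_nonneg_left (re_inner_le_re_inner_of_le hR x) ?_)
    exact add_nonneg (re_inner_nonneg_of_nonneg (opAbs_nonneg A) x) (by positivity)
  have hlim : Filter.Tendsto (fun ε : ℝ ↦
      ((⟪x, opAbs A x⟫_ℂ).re + ε * ‖x‖ ^ 2) * (⟪x, opAbs (adjoint A) x⟫_ℂ).re)
      (nhdsWithin 0 (Set.Ioi 0))
      (nhds ((⟪x, opAbs A x⟫_ℂ).re * (⟪x, opAbs (adjoint A) x⟫_ℂ).re)) :=
    tendsto_nhdsWithin_of_tendsto_nhds (Continuous.tendsto' (by fun_prop) _ _ (by simp))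
  exact ge_of_tendsto hlim (Filter.eventually_of_mem self_mem_nhdsWithin key)

/-- A hyponormal operator satisfies `|A*| ≤ |A|`. -/
lemma opAbs_adjoint_le_opAbs {A : H →L[ℂ] H} (hA : 0 ≤ adjoint A * A - A * adjoint A) :
    opAbs (adjoint A) ≤ opAbs A := by
  refine CFC.monotone_sqrt ?_
  rw [adjoint_adjoint]
  exact sub_nonneg.1 hA

end MixedSchwarz

lemma le_mul_add_of_sq_le_mul {t a b ξ : ℝ} (ha : 0 ≤ a + b) (hξ : 0 ≤ ξ)
    (hab : ξ * (a + b) ≤ a - b) (ht : t ^ 2 ≤ a * b) :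
    t ≤ 1 / (2 * (1 + ξ ^ 2 / 8)) * (a + b) := by
  have h1 : 4 * t ^ 2 ≤ (1 - ξ ^ 2) * (a + b) ^ 2 := by
    have := pow_le_pow_left₀ (mul_nonneg hξ ha) hab 2
    nlinarith
  have h2 : (1 - ξ ^ 2) * (1 + ξ ^ 2 / 8) ^ 2 ≤ 1 := by
    nlinarith [sq_nonneg ξ, sq_nonneg (ξ ^ 2), mul_nonneg (sq_nonneg ξ) (sq_nonneg (ξ ^ 2))]
  have h3 : (t * (2 * (1 + ξ ^ 2 / 8))) ^ 2 ≤ (a + b) ^ 2 := calc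
    (t * (2 * (1 + ξ ^ 2 / 8))) ^ 2 = 4 * t ^ 2 * (1 + ξ ^ 2 / 8) ^ 2 := by ring
    _ ≤ (1 - ξ ^ 2) * (a + b) ^ 2 * (1 + ξ ^ 2 / 8) ^ 2 := by gcongr
    _ = (1 - ξ ^ 2) * (1 + ξ ^ 2 / 8) ^ 2 * (a + b) ^ 2 := by ring
    _ ≤ 1 * (a + b) ^ 2 := by gcongr
    _ = (a + b) ^ 2 := one_mul _
  rw [one_div_mul_eq_div, le_div_iff₀ (by positivity)]
  exact le_of_abs_le (abs_le_of_sq_le_sq h3 ha)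

theorem numRadius_hyponormal_bound {H : Type*} [NormedAddCommGroup H] [InnerProductSpace ℂ H]
    [CompleteSpace H] (A : H →L[ℂ] H)
    (hhyp : 0 ≤ adjoint A * A - A * adjoint A)
    (hpos : ∀ x : H, ‖x‖ = 1 →
      0 < (⟪x, (opAbs A + opAbs (adjoint A)) x⟫_ℂ).re)
    (ξ : ℝ)
    (hξ : ξ = ⨅ x : {x : H // ‖x‖ = 1},
      (⟪(x : H), (opAbs A - opAbs (adjoint A)) x⟫_ℂ).re /
        (⟪(x : H), (opAbs A + opAbs (adjoint A)) x⟫_ℂ).re) :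
    numRadius A ≤ (1 / (2 * (1 + ξ ^ 2 / 8))) * ‖opAbs A + opAbs (adjoint A)‖ := by
  have hdiff (x : H) := re_inner_nonneg_of_nonneg (sub_nonneg.2 (opAbs_adjoint_le_opAbs hhyp)) x
  have hquot (x : {x : H // ‖x‖ = 1}) : 0 ≤
      (⟪(x : H), (opAbs A - opAbs (adjoint A)) x⟫_ℂ).re /
        (⟪(x : H), (opAbs A + opAbs (adjoint A)) x⟫_ℂ).re :=
    div_nonneg (hdiff x) (hpos x x.2).le
  have hξ0 : 0 ≤ ξ := hξ ▸ Real.iInf_nonneg hquot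
  refine Real.iSup_le (fun x ↦ ?_) (by positivity)
  have hξx := hξ.trans_le (ciInf_le ⟨0, Set.forall_mem_range.2 hquot⟩ x)
  rw [le_div_iff₀ (hpos x x.2)] at hξx
  have hsum := (hpos x x.2).le
  have hnorm : (⟪(x : H), (opAbs A + opAbs (adjoint A)) x⟫_ℂ).re ≤
      ‖opAbs A + opAbs (adjoint A)‖ := by
    refine (re_inner_le_norm (𝕜 := ℂ) _ _).trans ?_
    simpa [x.2] using (opAbs A + opAbs (adjoint A)).le_opNorm (x : H)
  refine le_trans ?_ (mul_le_mul_of_nonneg_left hnorm (by positivity))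
  simp only [add_apply, sub_apply, inner_add_right, inner_sub_right, Complex.add_re,
    Complex.sub_re] at hξx hsum ⊢
  exact le_mul_add_of_sq_le_mul hsum hξ0 hξx (norm_inner_apply_sq_le A x)
end

section
/- For any bounded linear operator A on a complex Hilbert space, ω(A) ≤ (1/2)·‖ |A| + |A*| ‖, where ω denotes the numerical radius, |A| = (A*A)^{1/2}, and |A*| = (AA*)^{1/2}. -/
open scoped InnerProductSpace
open ContinuousLinearMap

set_option synthInstance.maxHeartbeats 1000000

section

variable {H : Type*} [NormedAddCommGroup H] [InnerProductSpace ℂ H]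

/-- The operator `(x, y) ↦ (P x, Q y)` on the Hilbert sum `H ⊕ H`. -/
noncomputable def blockDiag (P Q : H →L[ℂ] H) : WithLp 2 (H × H) →L[ℂ] WithLp 2 (H × H) :=
  (WithLp.prodContinuousLinearEquiv 2 ℂ H H).symm.toContinuousLinearMap ∘L
    (P.prodMap Q) ∘L (WithLp.prodContinuousLinearEquiv 2 ℂ H H).toContinuousLinearMap

/-- The operator `(x, y) ↦ (B y, A x)` on the Hilbert sum `H ⊕ H`. -/
noncomputable def blockOffDiag (A B : H →L[ℂ] H) : WithLp 2 (H × H) →L[ℂ] WithLp 2 (H × H) :=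
  (WithLp.prodContinuousLinearEquiv 2 ℂ H H).symm.toContinuousLinearMap ∘L
    ((B ∘L ContinuousLinearMap.snd ℂ H H).prod (A ∘L ContinuousLinearMap.fst ℂ H H)) ∘L
      (WithLp.prodContinuousLinearEquiv 2 ℂ H H).toContinuousLinearMap

lemma blockDiag_apply (P Q : H →L[ℂ] H) (z : WithLp 2 (H × H)) :
    blockDiag P Q z = WithLp.toLp 2 (P z.fst, Q z.snd) := rfl

lemma blockOffDiag_apply (A B : H →L[ℂ] H) (z : WithLp 2 (H × H)) :
    blockOffDiag A B z = WithLp.toLp 2 (B z.snd, A z.fst) := rfl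

lemma blockDiag_nonneg {P Q : H →L[ℂ] H} (hP : 0 ≤ P) (hQ : 0 ≤ Q) : 0 ≤ blockDiag P Q := by
  rw [nonneg_iff_isPositive] at hP hQ ⊢
  rw [isPositive_iff_complex] at hP hQ ⊢
  intro z
  obtain ⟨h1, h2⟩ := hP z.fst
  obtain ⟨h3, h4⟩ := hQ z.snd
  simp only [blockDiag_apply, WithLp.prod_inner_apply]
  refine ⟨?_, ?_⟩
  · rw [map_add]
    push_cast
    exact congrArg₂ (· + ·) h1 h3
  · rw [map_add]
    exact add_nonneg h2 h4

variable [CompleteSpace H]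

lemma isSelfAdjoint_blockOffDiag_adjoint (A : H →L[ℂ] H) :
    IsSelfAdjoint (blockOffDiag A (adjoint A)) := by
  rw [isSelfAdjoint_iff_isSymmetric]
  intro z w
  simp [blockOffDiag_apply, WithLp.prod_inner_apply, adjoint_inner_left, adjoint_inner_right,
    add_comm]

lemma abs_blockOffDiag_adjoint (A : H →L[ℂ] H) :
    CFC.abs (blockOffDiag A (adjoint A)) =
      blockDiag (CFC.sqrt (adjoint A * A)) (CFC.sqrt (A * adjoint A)) := by
  have h1 : CFC.sqrt (adjoint A * A) * CFC.sqrt (adjoint A * A) = adjoint A * A :=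
    CFC.sqrt_mul_sqrt_self _ (star_mul_self_nonneg A)
  have h2 : CFC.sqrt (A * adjoint A) * CFC.sqrt (A * adjoint A) = A * adjoint A :=
    CFC.sqrt_mul_sqrt_self _ (mul_star_self_nonneg A)
  refine CFC.sqrt_unique ?_ (blockDiag_nonneg (CFC.sqrt_nonneg _) (CFC.sqrt_nonneg _))
  rw [(isSelfAdjoint_blockOffDiag_adjoint A).star_eq]
  ext1 z
  have h1' := DFunLike.congr_fun h1 z.fst
  have h2' := DFunLike.congr_fun h2 z.snd
  change WithLp.toLp 2 (_, _) = WithLp.toLp 2 (_, _)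
  exact congrArg (WithLp.toLp 2) (Prod.ext h1' h2')

/-- A form of the mixed Schwarz inequality. -/
lemma two_mul_re_inner_le (A : H →L[ℂ] H) (x y : H) :
    2 * (⟪y, A x⟫_ℂ).re ≤ (⟪CFC.sqrt (adjoint A * A) x, x⟫_ℂ).re +
      (⟪CFC.sqrt (A * adjoint A) y, y⟫_ℂ).re := by
  have hsa := isSelfAdjoint_blockOffDiag_adjoint A
  have h : 0 ≤ CFC.abs (blockOffDiag A (adjoint A)) - blockOffDiag A (adjoint A) := by
    rw [CFC.abs_sub_self _ hsa]
    exact nsmul_nonneg (CFC.negPart_nonneg _) 2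
  rw [abs_blockOffDiag_adjoint, nonneg_iff_isPositive] at h
  have h' := h.re_inner_nonneg_left (WithLp.toLp 2 (x, y))
  simp only [sub_apply, inner_sub_left, blockDiag_apply, blockOffDiag_apply,
    WithLp.prod_inner_apply, adjoint_inner_left, map_sub, map_add] at h'
  have hs : (⟪A x, y⟫_ℂ).re = (⟪y, A x⟫_ℂ).re := inner_re_symm (𝕜 := ℂ) _ _
  simp only [RCLike.re_to_complex, WithLp.toLp_fst, WithLp.toLp_snd, hs] at h'
  linarith

lemma two_mul_norm_inner_le (A : H →L[ℂ] H) (x : H) :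
    2 * ‖⟪x, A x⟫_ℂ‖ ≤
      (⟪(CFC.sqrt (adjoint A * A) + CFC.sqrt (A * adjoint A)) x, x⟫_ℂ).re := by
  obtain ⟨c, hc, hcx⟩ := RCLike.exists_norm_eq_mul_self (⟪x, A x⟫_ℂ)
  have h := two_mul_re_inner_le A x ((starRingEnd ℂ) c • x)
  have hcc : (starRingEnd ℂ) c * c = 1 := by
    rw [mul_comm, Complex.mul_conj, Complex.normSq_eq_norm_sq, hc]; simp
  rw [inner_smul_left, Complex.conj_conj, ← hcx, map_smul, inner_smul_left, inner_smul_right,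
    Complex.conj_conj, ← mul_assoc, mul_comm c, hcc, one_mul] at h
  rw [add_apply, inner_add_left, Complex.add_re]
  exact h

end

theorem numRadius_le_half_norm_abs_add {H : Type*} [NormedAddCommGroup H]
    [InnerProductSpace ℂ H] [CompleteSpace H] (A : H →L[ℂ] H) :
    numRadius A ≤ (1 / 2) * ‖CFC.sqrt (adjoint A * A) + CFC.sqrt (A * adjoint A)‖ := by
  refine Real.iSup_le (fun ⟨x, hx⟩ => ?_) (by positivity)
  have h := two_mul_norm_inner_le A x
  set S := CFC.sqrt (adjoint A * A) + CFC.sqrt (A * adjoint A)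
  have h2 : (⟪S x, x⟫_ℂ).re ≤ ‖S‖ := by
    calc (⟪S x, x⟫_ℂ).re ≤ ‖S x‖ * ‖x‖ := re_inner_le_norm (𝕜 := ℂ) _ _
      _ ≤ ‖S‖ * ‖x‖ * ‖x‖ := by gcongr; exact S.le_opNorm x
      _ = ‖S‖ := by rw [hx]; ring
  change ‖⟪x, A x⟫_ℂ‖ ≤ _
  linarith
end

section
/- If A and B are positive bounded operators on a complex Hilbert space, then ‖A + B‖ ≤ max(‖A‖, ‖B‖) + ‖A^{1/2} B^{1/2}‖. -/
open scoped InnerProductSpace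
open ContinuousLinearMap

set_option synthInstance.maxHeartbeats 1000000

/-- For self-adjoint `S` and `T`, the norm of `S ^ 2 + T ^ 2` is controlled by the norms of
`S`, `T` and `S * T`. -/
theorem norm_mul_self_add_mul_self_le {H : Type*} [NormedAddCommGroup H] [InnerProductSpace ℂ H]
    [CompleteSpace H] {S T : H →L[ℂ] H} (hS : IsSelfAdjoint S) (hT : IsSelfAdjoint T) :
    ‖S * S + T * T‖ ≤ max (‖S‖ ^ 2) (‖T‖ ^ 2) + ‖S * T‖ := by
  refine opNorm_le_bound _ (by positivity) fun x ↦ ?_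
  have symS (a b : H) : ⟪S a, b⟫_ℂ = ⟪a, S b⟫_ℂ := hS.isSymmetric a b
  have symT (a b : H) : ⟪T a, b⟫_ℂ = ⟪a, T b⟫_ℂ := hT.isSymmetric a b
  set y := (S * S + T * T) x with hy
  have hyx : y = S (S x) + T (T x) := by simp [hy]
  have energy_le : ‖S x‖ ^ 2 + ‖T x‖ ^ 2 ≤ ‖y‖ * ‖x‖ := by
    have h : ‖S x‖ ^ 2 + ‖T x‖ ^ 2 = RCLike.re ⟪y, x⟫_ℂ := by
      rw [hyx, inner_add_left, symS, symT, map_add, inner_self_eq_norm_sq, inner_self_eq_norm_sq]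
    exact h ▸ re_inner_le_norm y x
  have cross_le : RCLike.re ⟪S (S x), T (T x)⟫_ℂ ≤ ‖S * T‖ * (‖S x‖ * ‖T x‖) := by
    rw [symS]
    calc RCLike.re ⟪S x, S (T (T x))⟫_ℂ ≤ ‖S x‖ * ‖(S * T) (T x)‖ := re_inner_le_norm _ _
      _ ≤ ‖S x‖ * (‖S * T‖ * ‖T x‖) := by gcongr; exact le_opNorm _ _
      _ = _ := by ring
  have sq_le {R : H →L[ℂ] H} {m : ℝ} (hR : ‖R‖ ^ 2 ≤ m) (u : H) : ‖R u‖ ^ 2 ≤ m * ‖u‖ ^ 2 :=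
    calc ‖R u‖ ^ 2 ≤ (‖R‖ * ‖u‖) ^ 2 := by gcongr; exact le_opNorm _ _
      _ = ‖R‖ ^ 2 * ‖u‖ ^ 2 := by ring
      _ ≤ m * ‖u‖ ^ 2 := by gcongr
  have hSx := sq_le (le_max_left (‖S‖ ^ 2) (‖T‖ ^ 2)) (S x)
  have hTx := sq_le (le_max_right (‖S‖ ^ 2) (‖T‖ ^ 2)) (T x)
  set N := max (‖S‖ ^ 2) (‖T‖ ^ 2) + ‖S * T‖ with hN
  have hN0 : 0 ≤ N := by positivity
  have norm_sq_le : ‖y‖ ^ 2 ≤ N * (‖S x‖ ^ 2 + ‖T x‖ ^ 2) := by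
    rw [hyx, norm_add_sq (𝕜 := ℂ), hN]
    nlinarith [mul_nonneg (norm_nonneg (S * T)) (sq_nonneg (‖S x‖ - ‖T x‖))]
  rcases (norm_nonneg y).eq_or_lt with h0 | h0
  · rw [← h0]
    positivity
  · refine le_of_mul_le_mul_left ?_ h0
    calc ‖y‖ * ‖y‖ = ‖y‖ ^ 2 := by ring
      _ ≤ N * (‖y‖ * ‖x‖) := norm_sq_le.trans (by gcongr)
      _ = ‖y‖ * (N * ‖x‖) := by ring

theorem norm_add_le_max_add_sqrt {H : Type*} [NormedAddCommGroup H] [InnerProductSpace ℂ H]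
    [CompleteSpace H] (A B : H →L[ℂ] H) (hA : 0 ≤ A) (hB : 0 ≤ B) :
    ‖A + B‖ ≤ max ‖A‖ ‖B‖ + ‖CFC.sqrt A * CFC.sqrt B‖ := by
  have hS : IsSelfAdjoint (CFC.sqrt A) := (CFC.sqrt_nonneg A).isSelfAdjoint
  have hT : IsSelfAdjoint (CFC.sqrt B) := (CFC.sqrt_nonneg B).isSelfAdjoint
  have h := norm_mul_self_add_mul_self_le hS hT
  rwa [← hS.norm_mul_self, ← hT.norm_mul_self, CFC.sqrt_mul_sqrt_self A hA,
    CFC.sqrt_mul_sqrt_self B hB] at h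
end
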